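/- Let P be a convex polytope with ℓ nonconstant on edges satisfying the Stratification Assumption, and let u ⪯ w be vertices with O(u,w). Then dim F^-(u) + dim(F^+(u) ∩ F^-(w)) + dim F^+(w) = dim P. -/

import Mathlib

open Set

variable {V : Type*} [NormedAddCommGroup V] [NormedSpace ℝ V]

/-- A (nonempty) convex polytope: the convex hull of a nonempty finite set of points. -/
def IsPolytope (P : Set V) : Prop :=
  ∃ s : Finset V, s.Nonempty ∧ P = convexHull ℝ (s : Set V)

/-- A (nonempty exposed) face of a polytope. -/
def IsFace (P F : Set V) : Prop :=
  F.Nonempty ∧ IsExposed ℝ P F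

/-- A vertex of a polytope: a point whose singleton is a face. -/
def IsVertex (P : Set V) (v : V) : Prop := IsFace P {v}

/-- An edge of a polytope: a face which is a nondegenerate segment. -/
def IsEdge (P : Set V) (v w : V) : Prop := v ≠ w ∧ IsFace P (segment ℝ v w)

/-- `ℓ` attains its maximum on `G` at `v`. -/
def MaxAt (ℓ : V →L[ℝ] ℝ) (G : Set V) (v : V) : Prop := v ∈ G ∧ ∀ x ∈ G, ℓ x ≤ ℓ v

/-- `ℓ` attains its minimum on `G` at `v`. -/
def MinAt (ℓ : V →L[ℝ] ℝ) (G : Set V) (v : V) : Prop := v ∈ G ∧ ∀ x ∈ G, ℓ v ≤ ℓ x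

/-- `ℓ` is nonconstant on every edge of `P`. -/
def NonconstOnEdges (P : Set V) (ℓ : V →L[ℝ] ℝ) : Prop :=
  ∀ v w, IsEdge P v w → ℓ v ≠ ℓ w

/-- Directed edge: an edge oriented by increasing `ℓ`. -/
def DirEdge (P : Set V) (ℓ : V →L[ℝ] ℝ) (v w : V) : Prop := IsEdge P v w ∧ ℓ v < ℓ w

/-- The witness relation `O(v,w)`: some face of `P` has ℓ-minimum at `v` and
ℓ-maximum at `w`. -/
def ORel (P : Set V) (ℓ : V →L[ℝ] ℝ) (v w : V) : Prop :=
  ∃ G, IsFace P G ∧ MinAt ℓ G v ∧ MaxAt ℓ G w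

/-- `O⁻(v)`: the union of relative interiors of faces of `P` on which `ℓ` attains
its maximum at `v`. -/
def Oneg (P : Set V) (ℓ : V →L[ℝ] ℝ) (v : V) : Set V :=
  ⋃ G ∈ {G : Set V | IsFace P G ∧ MaxAt ℓ G v}, intrinsicInterior ℝ G

/-- `O⁺(v)`: the union of relative interiors of faces of `P` on which `ℓ` attains
its minimum at `v`. -/
def Opos (P : Set V) (ℓ : V →L[ℝ] ℝ) (v : V) : Set V :=
  ⋃ G ∈ {G : Set V | IsFace P G ∧ MinAt ℓ G v}, intrinsicInterior ℝ G

/-- `F⁻(v)`: the closure of `O⁻(v)`. -/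
def Fneg (P : Set V) (ℓ : V →L[ℝ] ℝ) (v : V) : Set V := closure (Oneg P ℓ v)

/-- `F⁺(v)`: the closure of `O⁺(v)`. -/
def Fpos (P : Set V) (ℓ : V →L[ℝ] ℝ) (v : V) : Set V := closure (Opos P ℓ v)

/-- The partition `O⁻` is a stratification. -/
def StratNeg (P : Set V) (ℓ : V →L[ℝ] ℝ) : Prop :=
  ∀ u w : V, IsVertex P u → IsVertex P w →
    (Oneg P ℓ u ∩ Fneg P ℓ w).Nonempty → Oneg P ℓ u ⊆ Fneg P ℓ w

/-- The dimension of a subset of `V` (dimension of its affine span). -/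
noncomputable def dimS (F : Set V) : ℕ := Module.finrank ℝ (vectorSpan ℝ F)

theorem isFace_iff {P F : Set V} : IsFace P F ↔ F.Nonempty ∧ ∃ (l : V →L[ℝ] ℝ) (c : ℝ),
    (∀ x ∈ P, l x ≤ c) ∧ F = {x ∈ P | l x = c} := by
  constructor
  · rintro ⟨hne, h⟩
    refine ⟨hne, ?_⟩
    obtain ⟨l, hl⟩ := h hne
    obtain ⟨p, hp⟩ := hne
    have hp' : p ∈ P ∧ ∀ y ∈ P, l y ≤ l p := by rw [hl] at hp; exact hp
    refine ⟨l, l p, hp'.2, ?_⟩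
    rw [hl]
    ext x
    simp only [mem_ofPred_eq]
    constructor
    · rintro ⟨h1, h2⟩
      exact ⟨h1, le_antisymm (hp'.2 x h1) (h2 p hp'.1)⟩
    · rintro ⟨h1, h2⟩
      exact ⟨h1, fun y hy => h2 ▸ hp'.2 y hy⟩
  · rintro ⟨hne, l, c, h1, rfl⟩
    refine ⟨hne, fun _ => ⟨l, ?_⟩⟩
    obtain ⟨p, hp, hpc⟩ := hne
    ext x
    simp only [mem_ofPred_eq]
    constructor
    · rintro ⟨hx, rfl⟩
      exact ⟨hx, h1⟩
    · rintro ⟨hx, h⟩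
      exact ⟨hx, le_antisymm (h1 x hx) (hpc ▸ h p hp)⟩

theorem hull_le {s : Set V} {l : V →L[ℝ] ℝ} {c : ℝ} (h : ∀ x ∈ s, l x ≤ c) :
    ∀ x ∈ convexHull ℝ s, l x ≤ c := by
  have : convexHull ℝ s ⊆ {x | l x ≤ c} :=
    convexHull_min h (convex_halfSpace_le l.toLinearMap.isLinear c)
  exact this

theorem hull_eq {s : Set V} {l : V →L[ℝ] ℝ} {c : ℝ} (h : ∀ x ∈ s, l x = c) :
    ∀ x ∈ convexHull ℝ s, l x = c := by
  have : convexHull ℝ s ⊆ {x | l x = c} :=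
    convexHull_min h (convex_hyperplane l.toLinearMap.isLinear c)
  exact this

theorem hull_face (s : Finset V) (l : V →L[ℝ] ℝ) (c : ℝ) (h : ∀ x ∈ s, l x ≤ c) :
    {x ∈ convexHull ℝ (s : Set V) | l x = c} =
      convexHull ℝ ((s.filter (fun x => l x = c) : Finset V) : Set V) := by
  ext x
  constructor
  · rintro ⟨hx, hc⟩
    obtain ⟨w, hw0, hw1, hwx⟩ := Finset.mem_convexHull'.1 hx
    have key : ∀ y ∈ s, w y * (c - l y) = 0 := by
      have hsum : ∑ y ∈ s, w y * (c - l y) = 0 := by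
        have : l x = ∑ y ∈ s, w y * l y := by rw [← hwx]; simp
        simp only [mul_sub, Finset.sum_sub_distrib, ← Finset.sum_mul, hw1, ← this, hc]
        ring
      exact (Finset.sum_eq_zero_iff_of_nonneg
        (fun y hy => mul_nonneg (hw0 y hy) (sub_nonneg.2 (h y hy)))).1 hsum
    have hz : ∀ y ∈ s, ¬ (l y = c) → w y = 0 := by
      intro y hy hne
      rcases mul_eq_zero.1 (key y hy) with h | h
      · exact h
      · exact absurd (by linarith) hne
    refine Finset.mem_convexHull'.2 ⟨w, fun y hy => hw0 y (Finset.mem_filter.1 hy).1, ?_, ?_⟩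
    · rw [← hw1]
      refine Finset.sum_subset (Finset.filter_subset _ _) ?_
      intro y hy hn
      exact hz y hy (fun h => hn (Finset.mem_filter.2 ⟨hy, h⟩))
    · rw [← hwx]
      refine Finset.sum_subset (Finset.filter_subset _ _) ?_
      intro y hy hn
      rw [hz y hy (fun h => hn (Finset.mem_filter.2 ⟨hy, h⟩)), zero_smul]
  · intro hx
    refine ⟨convexHull_mono (Finset.coe_subset.2 (Finset.filter_subset _ _)) hx, ?_⟩
    exact hull_eq (fun y hy => (Finset.mem_filter.1 hy).2) x hx

theorem face_polytope {P F : Set V} (hP : IsPolytope P) (hF : IsFace P F) : IsPolytope F := by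
  obtain ⟨hne, l, c, h1, rfl⟩ := isFace_iff.1 hF
  obtain ⟨s, hs, rfl⟩ := hP
  have h1' : ∀ x ∈ s, l x ≤ c := fun x hx => h1 x (subset_convexHull ℝ _ hx)
  rw [hull_face s l c h1'] at hne ⊢
  refine ⟨_, ?_, rfl⟩
  exact Finset.coe_nonempty.1 (convexHull_nonempty_iff.1 hne)

theorem face_refl {P : Set V} (hP : IsPolytope P) : IsFace P P := by
  obtain ⟨s, hs, rfl⟩ := hP
  exact ⟨convexHull_nonempty_iff.2 (Finset.coe_nonempty.2 hs), IsExposed.refl _⟩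

theorem face_trans {P F G : Set V} (hP : IsPolytope P) (hF : IsFace P F) (hG : IsFace F G) :
    IsFace P G := by
  obtain ⟨-, a, α, ha, rfl⟩ := isFace_iff.1 hF
  obtain ⟨hne, b, β, hb, rfl⟩ := isFace_iff.1 hG
  obtain ⟨s, hs, rfl⟩ := hP
  have hmem : ∀ x ∈ s, x ∈ convexHull ℝ (s : Set V) := fun x hx => subset_convexHull ℝ _ hx
  -- a large multiple
  obtain ⟨N, hN⟩ : ∃ N : ℝ, ∀ x ∈ s, (a x < α → b x - β < N * (α - a x)) := by
    have : ∀ x ∈ s, ∀ᶠ N : ℝ in Filter.atTop, (a x < α → b x - β < N * (α - a x)) := by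
      intro x hx
      by_cases h : a x < α
      · filter_upwards [Filter.eventually_gt_atTop ((b x - β) / (α - a x))] with N hN _
        exact (div_lt_iff₀ (sub_pos.2 h)).1 hN
      · exact Filter.Eventually.of_forall fun _ h' => absurd h' h
    exact ((Filter.eventually_all_finset s).2 this).exists
  have hle : ∀ x ∈ s, (N • a + b) x ≤ N * α + β := by
    intro x hx
    simp only [add_apply, smul_apply, smul_eq_mul]
    rcases lt_or_eq_of_le (ha x (hmem x hx)) with h | h
    · have := hN x hx h; nlinarith
    · have := hb x ⟨hmem x hx, h⟩; rw [h]; linarith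
  refine isFace_iff.2 ⟨hne, N • a + b, N * α + β, hull_le hle, ?_⟩
  ext x
  constructor
  · rintro ⟨⟨hx, h1⟩, h2⟩
    exact ⟨hx, by simp [h1, h2]⟩
  · intro hx
    have hx2 := hx
    rw [hull_face s _ _ hle] at hx2
    have hflt : ∀ y ∈ s.filter (fun x => (N • a + b) x = N * α + β), a y = α ∧ b y = β := by
      intro y hy
      obtain ⟨hy, he⟩ := Finset.mem_filter.1 hy
      simp only [add_apply, smul_apply, smul_eq_mul] at he
      rcases lt_or_eq_of_le (ha y (hmem y hy)) with h | h
      · have := hN y hy h; exfalso; nlinarith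
      · exact ⟨h, by rw [h] at he; linarith⟩
    exact ⟨⟨hx.1, hull_eq (fun y hy => (hflt y hy).1) x hx2⟩,
      hull_eq (fun y hy => (hflt y hy).2) x hx2⟩

theorem face_mono {P F G : Set V} (hG : IsFace P G) (hFP : F ⊆ P) (hGF : G ⊆ F) : IsFace F G :=
  ⟨hG.1, hG.2.mono hFP hGF⟩

theorem poly_fin {P : Set V} (hP : IsPolytope P) : FiniteDimensional ℝ (vectorSpan ℝ P) := by
  obtain ⟨s, hs, rfl⟩ := hP
  rw [← direction_affineSpan, affineSpan_convexHull, direction_affineSpan]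
  exact finiteDimensional_vectorSpan_of_finite ℝ s.finite_toSet

theorem vs_le_ker {F : Set V} {l : V →L[ℝ] ℝ} {c : ℝ} (h : ∀ x ∈ F, l x = c) :
    vectorSpan ℝ F ≤ LinearMap.ker l.toLinearMap := by
  rw [vectorSpan, Submodule.span_le]
  rintro _ ⟨x, hx, y, hy, rfl⟩
  simp [h x hx, h y hy]

theorem const_of_ker {F : Set V} {l : V →L[ℝ] ℝ} (h : vectorSpan ℝ F ≤ LinearMap.ker l.toLinearMap)
    {x y : V} (hx : x ∈ F) (hy : y ∈ F) : l x = l y := by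
  have := h (vsub_mem_vectorSpan ℝ hx hy)
  simpa [sub_eq_zero] using this

theorem face_eq_of_vs {Q F G : Set V} (hF : IsFace Q F) (hG : G ⊆ Q) (hu : (F ∩ G).Nonempty)
    (h : vectorSpan ℝ G ≤ vectorSpan ℝ F) : G ⊆ F := by
  obtain ⟨hne, l, c, h1, rfl⟩ := isFace_iff.1 hF
  intro x hx
  obtain ⟨u, hu1, hu2⟩ := hu
  have hk : vectorSpan ℝ {x | x ∈ Q ∧ l x = c} ≤ _ := vs_le_ker (l := l) (c := c) (fun x hx => hx.2)
  exact ⟨hG hx, (const_of_ker (h.trans hk) hx hu2).trans hu1.2⟩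

theorem dim_lt {Q F : Set V} (hQ : IsPolytope Q) (hF : IsFace Q F) (hne : F ≠ Q) :
    dimS F < dimS Q := by
  have := poly_fin hQ
  refine Submodule.finrank_lt_finrank_of_lt (lt_of_le_of_ne (vectorSpan_mono ℝ hF.2.subset) ?_)
  intro h
  obtain ⟨p, hp⟩ := hF.1
  exact hne (hF.2.subset.antisymm (face_eq_of_vs hF subset_rfl ⟨p, hp, hF.2.subset hp⟩ h.ge))

theorem exists_func (W : Submodule ℝ V) [FiniteDimensional ℝ W] {x : V} (hx : x ∉ W) :
    ∃ f : V →L[ℝ] ℝ, W ≤ LinearMap.ker f.toLinearMap ∧ f x ≠ 0 := by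
  obtain ⟨f, c, h1, h2⟩ := geometric_hahn_banach_closed_point (s := (W : Set V)) W.convex
    W.closed_of_finiteDimensional hx
  have hz : ∀ a ∈ W, f a = 0 := by
    intro a ha
    by_contra hne
    have := h1 _ (W.smul_mem (c / f a) ha)
    simp [hne] at this
  refine ⟨f, fun a ha => hz a ha, ?_⟩
  have := h1 0 W.zero_mem
  simp at this
  linarith

/-- Facet existence. -/
theorem exists_facet {Q : Set V} (hQ : IsPolytope Q) {u w : V} (hu : IsFace Q {u}) (hw : w ∈ Q)
    (huw : u ≠ w) : ∃ G, IsFace Q G ∧ u ∈ G ∧ w ∉ G ∧ dimS Q ≤ dimS G + 1 := by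
  have hfin := poly_fin hQ
  by_contra! hcon
  have hbig : ∀ n : ℕ, ∃ G, IsFace Q G ∧ u ∈ G ∧ w ∉ G ∧ n ≤ dimS G := by
    intro n
    induction n with
    | zero => exact ⟨{u}, hu, rfl, fun h => huw h.symm, Nat.zero_le _⟩
    | succ n ih =>
      obtain ⟨G, hG, huG, hwG, hn⟩ := ih
      have hlt := hcon G hG huG hwG
      obtain ⟨hGne, a, c, ha, hGeq⟩ := isFace_iff.1 hG
      have hGfin := poly_fin (face_polytope hQ hG)
      let W := vectorSpan ℝ G ⊔ Submodule.span ℝ {w - u}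
      have hWdim : Module.finrank ℝ W ≤ dimS G + 1 := by
        refine (Submodule.finrank_add_le_finrank_add_finrank _ _).trans ?_
        exact Nat.add_le_add_left ((finrank_span_le_card {w - u}).trans (by simp)) _
      have hnle : ¬ vectorSpan ℝ Q ≤ W := by
        intro h
        have h1 := Submodule.finrank_mono h
        change dimS Q ≤ _ at h1
        omega
      obtain ⟨x, hxQ, hxW⟩ := SetLike.not_le_iff_exists.1 hnle
      obtain ⟨g0, hg0, hg0x⟩ := exists_func W hxW
      obtain ⟨s, hs, rfl⟩ := hQ
      have hmem : ∀ x ∈ s, x ∈ convexHull ℝ (s : Set V) := fun x hx => subset_convexHull ℝ _ hx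
      have hsx : ∃ y ∈ s, g0 y ≠ g0 u := by
        by_contra! hall
        have := vs_le_ker (hull_eq (s := (s : Set V)) (l := g0) (c := g0 u) hall)
        exact hg0x (this hxQ)
      -- choose the sign
      obtain ⟨g, hg, hgx⟩ : ∃ g : V →L[ℝ] ℝ, W ≤ LinearMap.ker g.toLinearMap ∧
          ∃ y ∈ s, g u < g y := by
        obtain ⟨y, hy, hne⟩ := hsx
        rcases lt_or_gt_of_ne hne with h | h
        · refine ⟨-g0, fun z hz => ?_, y, hy, by simpa using h⟩
          have : g0 z = 0 := hg0 hz
          simp [this]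
        · exact ⟨g0, hg0, y, hy, h⟩
      have hgG : ∀ z ∈ G, g z = g u := fun z hz =>
        const_of_ker (le_sup_left.trans hg) hz huG
      have hgw : g w = g u := by
        have : g (w - u) = 0 := hg (le_sup_right (a := vectorSpan ℝ G)
          (Submodule.mem_span_singleton_self _))
        simpa [sub_eq_zero] using this
      have hau : a u = c := by rw [hGeq] at huG; exact huG.2
      have halt : ∀ y ∈ convexHull ℝ (s : Set V), y ∉ G → a y < c := by
        intro y hy hn
        refine lt_of_le_of_ne (ha y hy) fun h => hn ?_
        rw [hGeq]; exact ⟨hy, h⟩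
      let S := s.filter (fun y => g u < g y)
      have hS : S.Nonempty := by
        obtain ⟨y, hy, h⟩ := hgx
        exact ⟨y, Finset.mem_filter.2 ⟨hy, h⟩⟩
      obtain ⟨y, hyS, hmin⟩ := S.exists_min_image (fun y => (c - a y) / (g y - g u)) hS
      obtain ⟨hys, hyg⟩ := Finset.mem_filter.1 hyS
      have hyG : y ∉ G := fun h => by rw [hgG y h] at hyg; exact lt_irrefl _ hyg
      set t := (c - a y) / (g y - g u) with ht
      have htpos : 0 < t := div_pos (sub_pos.2 (halt y (hmem y hys) hyG)) (sub_pos.2 hyg)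
      have hbs : ∀ z ∈ s, (a + t • g) z ≤ c + t * g u := by
        intro z hz
        simp only [add_apply, smul_apply, smul_eq_mul]
        by_cases h : g u < g z
        · have := hmin z (Finset.mem_filter.2 ⟨hz, h⟩)
          have := (le_div_iff₀ (sub_pos.2 h)).1 this
          linarith
        · have := ha z (hmem z hz)
          nlinarith
      have hyeq : (a + t • g) y = c + t * g u := by
        simp only [add_apply, smul_apply, smul_eq_mul]
        have : t * (g y - g u) = c - a y := div_mul_cancel₀ _ (sub_pos.2 hyg).ne'
        linarith
      let G2 : Set V := {x ∈ convexHull ℝ (s : Set V) | (a + t • g) x = c + t * g u}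
      have hGG2 : G ⊆ G2 := by
        intro z hz
        refine ⟨hG.2.subset hz, ?_⟩
        have h1 : a z = c := by rw [hGeq] at hz; exact hz.2
        simp [h1, hgG z hz]
      have hG2 : IsFace (convexHull ℝ (s : Set V)) G2 :=
        isFace_iff.2 ⟨⟨u, hGG2 huG⟩, _, _, hull_le hbs, rfl⟩
      refine ⟨G2, hG2, hGG2 huG, ?_, ?_⟩
      · rintro ⟨_, h⟩
        have := halt w hw hwG
        simp only [add_apply, smul_apply, smul_eq_mul,
          hgw] at h
        linarith
      · have : dimS G < dimS G2 := by
          refine dim_lt (face_polytope ⟨s, hs, rfl⟩ hG2) (face_mono hG hG2.2.subset hGG2) ?_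
          rintro rfl
          exact hyG ⟨hmem y hys, hyeq⟩
        omega
  obtain ⟨G, hG, -, -, h⟩ := hbig (dimS Q + 1)
  have : dimS G ≤ dimS Q := Submodule.finrank_mono (vectorSpan_mono ℝ hG.2.subset)
  omega

theorem poly_compact {P : Set V} (hP : IsPolytope P) : IsCompact P := by
  obtain ⟨s, hs, rfl⟩ := hP
  exact s.finite_toSet.isCompact_convexHull (𝕜 := ℝ)

theorem poly_convex {P : Set V} (hP : IsPolytope P) : Convex ℝ P := by
  obtain ⟨s, hs, rfl⟩ := hP
  exact convex_convexHull ℝ _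

theorem seg_of_dim_one {Q : Set V} (hQ : IsPolytope Q) {u x0 : V} (hu : IsFace Q {u})
    (hx0 : x0 ∈ Q) (hne : x0 ≠ u) (hd : dimS Q ≤ 1) : ∃ y, y ≠ u ∧ Q = segment ℝ u y := by
  have hfin := poly_fin hQ
  have huQ : u ∈ Q := hu.2.subset rfl
  obtain ⟨-, φ, c, hφ, heq⟩ := isFace_iff.1 hu
  have hφu : φ u = c := by
    have : u ∈ ({u} : Set V) := rfl
    rw [heq] at this; exact this.2
  have hlt : ∀ x ∈ Q, x ≠ u → φ x < c := by
    intro x hx hn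
    refine lt_of_le_of_ne (hφ x hx) fun h => hn ?_
    have : x ∈ ({u} : Set V) := by rw [heq]; exact ⟨hx, h⟩
    exact this
  obtain ⟨y, hyQ, hy⟩ := (poly_compact hQ).exists_isMinOn ⟨u, huQ⟩ φ.continuous.continuousOn
  have hyc : φ y < c := lt_of_le_of_lt (hy hx0) (hlt x0 hx0 hne)
  have hyu : y ≠ u := by rintro rfl; exact hyc.ne hφu
  refine ⟨y, hyu, ?_⟩
  have hspan : Submodule.span ℝ {y - u} = vectorSpan ℝ Q := by
    apply Submodule.eq_of_le_of_finrank_le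
    · rw [Submodule.span_singleton_le_iff_mem]
      exact vsub_mem_vectorSpan ℝ hyQ huQ
    · rw [finrank_span_singleton (sub_ne_zero.2 hyu)]
      exact hd
  apply Subset.antisymm
  · intro x hx
    have hxm : x - u ∈ Submodule.span ℝ {y - u} := by
      rw [hspan]; exact vsub_mem_vectorSpan ℝ hx huQ
    obtain ⟨r, hr⟩ := Submodule.mem_span_singleton.1 hxm
    have h1 : r * (φ y - c) = φ x - c := by
      have := congrArg φ hr
      simpa [hφu] using this
    have h2 : φ y ≤ φ x := hy hx
    have h3 := hφ x hx
    rw [segment_eq_image']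
    refine ⟨r, ⟨?_, ?_⟩, ?_⟩
    · by_contra hneg; push Not at hneg; nlinarith
    · by_contra hneg; push Not at hneg; nlinarith
    · simp [hr]
  · exact (poly_convex hQ).segment_subset huQ hyQ

theorem exists_edge_aux (n : ℕ) : ∀ (Q : Set V), dimS Q = n → IsPolytope Q → ∀ {u x0 : V}
    (f : V →L[ℝ] ℝ), IsFace Q {u} → x0 ∈ Q → f x0 ≠ f u →
    ∃ y, u ≠ y ∧ IsFace Q (segment ℝ u y) ∧ f y ≠ f u := by
  induction n using Nat.strong_induction_on with
  | _ n ih =>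
  intro Q hdim hQ u x0 f hu hx0 hf
  have hfin := poly_fin hQ
  have hne : u ≠ x0 := by rintro rfl; exact hf rfl
  have huQ : u ∈ Q := hu.2.subset rfl
  by_cases hG : ∃ G, IsFace Q G ∧ u ∈ G ∧ G ≠ Q ∧ ∃ x ∈ G, f x ≠ f u
  · obtain ⟨G, hG, huG, hGQ, x, hx, hfx⟩ := hG
    obtain ⟨y, h1, h2, h3⟩ := ih (dimS G) (hdim ▸ dim_lt hQ hG hGQ) G rfl (face_polytope hQ hG) f
      (face_mono hu hG.2.subset (by simpa using huG)) hx hfx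
    exact ⟨y, h1, face_trans hQ hG h2, h3⟩
  · push Not at hG
    have hd1 : dimS Q ≤ 1 := by
      obtain ⟨G', hG', huG', hxG', hd'⟩ := exists_facet hQ hu hx0 hne
      by_cases hs : G' = {u}
      · subst hs
        have : dimS ({u} : Set V) = 0 := by simp [dimS]
        omega
      · exfalso
        obtain ⟨w', hw', hwu⟩ : ∃ w' ∈ G', w' ≠ u := by
          by_contra! hall
          exact hs (Subset.antisymm hall (by simpa using huG'))
        obtain ⟨G2, hG2, huG2, hwG2, hd2⟩ := exists_facet hQ hu (hG'.2.subset hw') hwu.symm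
        let W := vectorSpan ℝ Q ⊓ LinearMap.ker f.toLinearMap
        have hWlt : Module.finrank ℝ W < dimS Q := by
          refine Submodule.finrank_lt_finrank_of_lt (lt_of_le_of_ne inf_le_left ?_)
          intro h
          exact hf (const_of_ker (inf_eq_left.1 h) hx0 huQ)
        have hWfin : FiniteDimensional ℝ W := Submodule.finiteDimensional_inf_left _ _
        have key : ∀ G, IsFace Q G → u ∈ G → G ≠ Q → dimS Q ≤ dimS G + 1 → vectorSpan ℝ G = W := by
          intro G h1 h2 h3 h4
          apply Submodule.eq_of_le_of_finrank_le
          · exact le_inf (vectorSpan_mono ℝ h1.2.subset) (vs_le_ker (hG G h1 h2 h3))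
          · change _ ≤ dimS G
            omega
        have e1 := key G' hG' huG' (fun h => hxG' (h ▸ hx0)) hd'
        have e2 := key G2 hG2 huG2 (fun h => hwG2 (h ▸ hG'.2.subset hw')) hd2
        exact hwG2 (face_eq_of_vs hG2 hG'.2.subset ⟨u, huG2, huG'⟩ (e1.trans e2.symm).le hw')
    obtain ⟨y, hyu, rfl⟩ := seg_of_dim_one hQ hu hx0 hne.symm hd1
    refine ⟨y, hyu.symm, face_refl hQ, fun hy => hf ?_⟩
    rw [segment_eq_image'] at hx0
    obtain ⟨r, -, rfl⟩ := hx0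
    simp [hy]

theorem exists_edge {P Q : Set V} (hP : IsPolytope P) (hQ : IsFace P Q) {u x0 : V}
    (f : V →L[ℝ] ℝ) (hu : IsVertex P u) (huQ : u ∈ Q) (hx0 : x0 ∈ Q) (hf : f x0 ≠ f u) :
    ∃ y, IsEdge P u y ∧ segment ℝ u y ⊆ Q ∧ f y ≠ f u := by
  obtain ⟨y, h1, h2, h3⟩ := exists_edge_aux _ Q rfl (face_polytope hP hQ) f
    (face_mono hu hQ.2.subset (by simpa using huQ)) hx0 hf
  exact ⟨y, ⟨h1, face_trans hP hQ h2⟩, h2.2.subset, h3⟩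

theorem exists_max_face {Q : Set V} (hQ : IsPolytope Q) (f : V →L[ℝ] ℝ) :
    ∃ m ∈ Q, (∀ x ∈ Q, f x ≤ f m) ∧ IsFace Q {x ∈ Q | f x = f m} := by
  obtain ⟨m, hm, h⟩ := (poly_compact hQ).exists_isMaxOn (face_refl hQ).1 f.continuous.continuousOn
  exact ⟨m, hm, h, isFace_iff.2 ⟨⟨m, hm, rfl⟩, f, f m, h, rfl⟩⟩

theorem exists_vertex_aux (n : ℕ) : ∀ (Q : Set V), dimS Q = n → IsPolytope Q →
    ∃ v, IsVertex Q v := by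
  induction n using Nat.strong_induction_on with
  | _ n ih =>
  intro Q hdim hQ
  obtain ⟨p, hp⟩ := (face_refl hQ).1
  by_cases h : ∃ q ∈ Q, q ≠ p
  · obtain ⟨q, hq, hqp⟩ := h
    obtain ⟨f, hf⟩ := geometric_hahn_banach_point_point hqp
    obtain ⟨m, hm, hmax, hF⟩ := exists_max_face hQ f
    have hne : {x ∈ Q | f x = f m} ≠ Q := by
      intro he
      have h1 : q ∈ {x ∈ Q | f x = f m} := he.symm ▸ hq
      have h2 : p ∈ {x ∈ Q | f x = f m} := he.symm ▸ hp
      exact hf.ne (h1.2.trans h2.2.symm)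
    obtain ⟨v, hv⟩ := ih _ (hdim ▸ dim_lt hQ hF hne) _ rfl (face_polytope hQ hF)
    exact ⟨v, face_trans hQ hF hv⟩
  · push Not at h
    have : Q = {p} := Subset.antisymm h (by simpa using hp)
    exact ⟨p, by rw [IsVertex, ← this]; exact face_refl hQ⟩

/-- Every face has a vertex of `P` at which `f` is maximal. -/
theorem exists_max_vertex {P Q : Set V} (hP : IsPolytope P) (hQ : IsFace P Q) (f : V →L[ℝ] ℝ) :
    ∃ v, IsVertex P v ∧ MaxAt f Q v := by
  have hQp := face_polytope hP hQ
  obtain ⟨m, hm, hmax, hF⟩ := exists_max_face hQp f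
  obtain ⟨v, hv⟩ := exists_vertex_aux _ _ rfl (face_polytope hQp hF)
  have hvm : v ∈ {x ∈ Q | f x = f m} := hv.2.subset rfl
  exact ⟨v, face_trans hP hQ (face_trans hQp hF hv), hvm.1, fun x hx => hvm.2 ▸ hmax x hx⟩

/-- Faces on which `ℓ` is constant are points. -/
theorem const_face {P G : Set V} (hP : IsPolytope P) {ℓ : V →L[ℝ] ℝ} (hℓ : NonconstOnEdges P ℓ)
    (hG : IsFace P G) {v x : V} (hv : IsVertex P v) (hvG : v ∈ G) (hc : ∀ y ∈ G, ℓ y = ℓ v)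
    (hx : x ∈ G) : x = v := by
  by_contra hne
  obtain ⟨f, hf⟩ := geometric_hahn_banach_point_point hne
  obtain ⟨y, hy, hsub, -⟩ := exists_edge hP hG f hv hvG hx hf.ne
  exact hℓ v y hy (hc y (hsub (right_mem_segment ℝ v y))).symm

theorem max_unique {P G : Set V} (hP : IsPolytope P) {ℓ : V →L[ℝ] ℝ} (hℓ : NonconstOnEdges P ℓ)
    (hG : IsFace P G) {v x : V} (hv : IsVertex P v) (hm : MaxAt ℓ G v) (hx : x ∈ G)
    (hxv : ℓ x = ℓ v) : x = v := by
  have hF : IsFace G {x ∈ G | ℓ x = ℓ v} := isFace_iff.2 ⟨⟨v, hm.1, rfl⟩, ℓ, ℓ v, hm.2, rfl⟩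
  exact const_face hP hℓ (face_trans hP hG hF) hv ⟨hm.1, rfl⟩ (fun y hy => hy.2) ⟨hx, hxv⟩

private theorem aux_homeo {α β : Type*} [TopologicalSpace α] [TopologicalSpace β] (φ : α ≃ₜ β)
    (s : Set β) : (interior s).Nonempty ↔ (interior (φ ⁻¹' s)).Nonempty := by
  rw [← φ.image_symm, ← φ.symm.image_interior, image_nonempty]

theorem intInt_nonempty {s : Set V} (hs : IsPolytope s) : (intrinsicInterior ℝ s).Nonempty := by
  have hscv := poly_convex hs
  have hfin := poly_fin hs
  have hsne := (face_refl hs).1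
  have := hsne.coe_sort
  obtain ⟨p, hp⟩ := hsne
  let p' : _root_.affineSpan ℝ s := ⟨p, subset_affineSpan _ _ hp⟩
  have : FiniteDimensional ℝ (affineSpan ℝ s).direction := by
    rw [direction_affineSpan]; exact hfin
  rw [intrinsicInterior, image_nonempty,
    aux_homeo (AffineIsometryEquiv.constVSub ℝ p').symm.toHomeomorph,
    Convex.interior_nonempty_iff_affineSpan_eq_top, AffineIsometryEquiv.coe_toHomeomorph, ←
    AffineIsometryEquiv.coe_toAffineEquiv, ← AffineSubspace.comap_span,
    affineSpan_coe_preimage_eq_top, AffineSubspace.comap_top]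
  exact hscv.affine_preimage
    ((_root_.affineSpan ℝ s).subtype.comp
      (AffineIsometryEquiv.constVSub ℝ p').symm.toAffineEquiv.toAffineMap)

/-- A face meeting the relative interior of a subset contains it. -/
theorem face_of_intInt {P F G : Set V} (hF : IsFace P F) (hG : G ⊆ P) {p : V}
    (hp : p ∈ intrinsicInterior ℝ G) (hpF : p ∈ F) : G ⊆ F := by
  intro x hx
  obtain ⟨-, l, c, h1, rfl⟩ := isFace_iff.1 hF
  refine ⟨hG hx, le_antisymm (h1 x (hG hx)) ?_⟩
  obtain ⟨q, hq, rfl⟩ := mem_intrinsicInterior.1 hp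
  let x' : affineSpan ℝ G := ⟨x, subset_affineSpan ℝ _ hx⟩
  have : Nonempty (affineSpan ℝ G) := ⟨x'⟩
  have hcont : Continuous (fun t : ℝ => AffineMap.lineMap (k := ℝ) q x' t) :=
    AffineMap.lineMap_continuous
  have h0 : ∀ᶠ t in nhds (0 : ℝ), AffineMap.lineMap q x' t ∈ ((↑) ⁻¹' G : Set (affineSpan ℝ G)) := by
    apply hcont.continuousAt.eventually
    simp only [AffineMap.lineMap_apply_zero]
    exact mem_interior_iff_mem_nhds.1 hq
  have h2 := h0.filter_mono (nhdsWithin_le_nhds (s := Iio (0 : ℝ)))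
  obtain ⟨t, ht, htn⟩ := (h2.and self_mem_nhdsWithin).exists
  have ht' : ((AffineMap.lineMap q x' t : affineSpan ℝ G) : V) ∈ G := ht
  have h3 := h1 _ (hG ht')
  have h4 : ((AffineMap.lineMap q x' t : affineSpan ℝ G) : V) = t • (x - q) + q := by
    simp [AffineMap.lineMap_apply, x']
  rw [h4] at h3
  have h5 : l (q : V) = c := hpF.2
  have htn' : t < 0 := htn
  simp only [map_add, map_smul, map_sub, smul_eq_mul, h5] at h3
  nlinarith

section main

variable {P : Set V} {ℓ : V →L[ℝ] ℝ}

theorem self_mem_Oneg {v : V} (hv : IsVertex P v) : v ∈ Oneg P ℓ v := by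
  simp only [Oneg, mem_iUnion]
  refine ⟨{v}, ⟨hv, rfl, ?_⟩, by simp⟩
  rintro x rfl; exact le_rfl

theorem self_mem_Opos {v : V} (hv : IsVertex P v) : v ∈ Opos P ℓ v := by
  simp only [Opos, mem_iUnion]
  refine ⟨{v}, ⟨hv, rfl, ?_⟩, by simp⟩
  rintro x rfl; exact le_rfl

theorem maxAt_Fneg {v : V} (hv : IsVertex P v) : MaxAt ℓ (Fneg P ℓ v) v := by
  refine ⟨subset_closure (self_mem_Oneg hv), ?_⟩
  have : Fneg P ℓ v ⊆ {x | ℓ x ≤ ℓ v} := by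
    refine closure_minimal ?_ (isClosed_le ℓ.continuous continuous_const)
    intro x hx
    simp only [Oneg, mem_iUnion] at hx
    obtain ⟨G, ⟨hG, hm⟩, hx⟩ := hx
    exact hm.2 x (intrinsicInterior_subset hx)
  exact this

theorem minAt_Fpos {v : V} (hv : IsVertex P v) : MinAt ℓ (Fpos P ℓ v) v := by
  refine ⟨subset_closure (self_mem_Opos hv), ?_⟩
  have : Fpos P ℓ v ⊆ {x | ℓ v ≤ ℓ x} := by
    refine closure_minimal ?_ (isClosed_le continuous_const ℓ.continuous)
    intro x hx
    simp only [Opos, mem_iUnion] at hx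
    obtain ⟨G, ⟨hG, hm⟩, hx⟩ := hx
    exact hm.2 x (intrinsicInterior_subset hx)
  exact this

theorem sub_Fneg (hP : IsPolytope P) {v : V} (hF : IsFace P (Fneg P ℓ v)) {G : Set V}
    (hG : IsFace P G) (hm : MaxAt ℓ G v) : G ⊆ Fneg P ℓ v := by
  obtain ⟨p, hp⟩ := intInt_nonempty (face_polytope hP hG)
  refine face_of_intInt hF hG.2.subset hp (subset_closure ?_)
  simp only [Oneg, mem_iUnion]
  exact ⟨G, ⟨hG, hm⟩, hp⟩

theorem sub_Fpos (hP : IsPolytope P) {v : V} (hF : IsFace P (Fpos P ℓ v)) {G : Set V}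
    (hG : IsFace P G) (hm : MinAt ℓ G v) : G ⊆ Fpos P ℓ v := by
  obtain ⟨p, hp⟩ := intInt_nonempty (face_polytope hP hG)
  refine face_of_intInt hF hG.2.subset hp (subset_closure ?_)
  simp only [Opos, mem_iUnion]
  exact ⟨G, ⟨hG, hm⟩, hp⟩

theorem Fneg_mono (hstrat : StratNeg P ℓ) {u w : V} (hu : IsVertex P u) (hw : IsVertex P w)
    (h : u ∈ Fneg P ℓ w) : Fneg P ℓ u ⊆ Fneg P ℓ w :=
  closure_minimal (hstrat u w hu hw ⟨u, self_mem_Oneg hu, h⟩) isClosed_closure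

theorem upper_bound (hP : IsPolytope P) (hℓ : NonconstOnEdges P ℓ)
    (hirr : ∀ v, IsVertex P v → IsFace P (Fneg P ℓ v) ∧ IsFace P (Fpos P ℓ v))
    (hstrat : StratNeg P ℓ) {u : V} (hu : IsVertex P u) (n : ℕ) :
    ∀ (G : Set V) (w : V), dimS G = n → IsFace P G → IsVertex P w → MinAt ℓ G u → MaxAt ℓ G w →
      dimS (Fneg P ℓ u) + dimS G ≤ dimS (Fneg P ℓ w) := by
  induction n using Nat.strong_induction_on with
  | _ n ih =>
  intro G w hdim hG hw hmin hmax
  have hGp := face_polytope hP hG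
  by_cases huw : u = w
  · subst huw
    have : G = {u} := by
      refine Subset.antisymm (fun x hx => ?_) (by simpa using hmin.1)
      exact max_unique hP hℓ hG hu hmax hx (le_antisymm (hmax.2 x hx) (hmin.2 x hx))
    have h0 : dimS G = 0 := by rw [this]; simp [dimS]
    omega
  · obtain ⟨G', hG', huG', hwG', hd⟩ := exists_facet hGp
      (face_mono hu hG.2.subset (by simpa using hmin.1)) hmax.1 huw
    have hlt : dimS G' < dimS G := dim_lt hGp hG' (fun h => hwG' (h ▸ hmax.1))
    have hG'P := face_trans hP hG hG'
    obtain ⟨v, hv, hvm⟩ := exists_max_vertex hP hG'P ℓ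
    have h1 := ih _ (hdim ▸ hlt) G' v rfl hG'P hv ⟨huG', fun x hx => hmin.2 x (hG'.2.subset hx)⟩ hvm
    have hvG : v ∈ G := hG'.2.subset hvm.1
    have hsub := Fneg_mono hstrat hv hw (sub_Fneg hP (hirr w hw).1 hG hmax hvG)
    have h2 : dimS (Fneg P ℓ v) < dimS (Fneg P ℓ w) := by
      refine dim_lt (face_polytope hP (hirr w hw).1)
        (face_mono (hirr v hv).1 (hirr w hw).1.2.subset hsub) fun he => ?_
      have hwv : w ∈ Fneg P ℓ v := he.symm ▸ (maxAt_Fneg hw).1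
      have h3 : v = w := max_unique hP hℓ hG hw hmax hvG
        (le_antisymm (hmax.2 v hvG) ((maxAt_Fneg hv).2 w hwv))
      exact hwG' (h3 ▸ hvm.1)
    omega

theorem lower_bound (hP : IsPolytope P) (hℓ : NonconstOnEdges P ℓ)
    (hirr : ∀ v, IsVertex P v → IsFace P (Fneg P ℓ v) ∧ IsFace P (Fpos P ℓ v))
    {u : V} (hu : IsVertex P u) {Q : Set V} (hQ : IsFace P Q) (huQ : u ∈ Q) :
    dimS Q ≤ dimS (Fneg P ℓ u) + dimS (Fpos P ℓ u ∩ Q) := by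
  have hE : IsFace P (Fpos P ℓ u ∩ Q) :=
    ⟨⟨u, (minAt_Fpos hu).1, huQ⟩, (hirr u hu).2.2.inter hQ.2⟩
  have f1 := poly_fin (face_polytope hP (hirr u hu).1)
  have f2 := poly_fin (face_polytope hP hE)
  have hle : vectorSpan ℝ Q ≤ vectorSpan ℝ (Fneg P ℓ u) ⊔ vectorSpan ℝ (Fpos P ℓ u ∩ Q) := by
    by_contra hnle
    obtain ⟨x, hxQ, hxW⟩ := SetLike.not_le_iff_exists.1 hnle
    obtain ⟨f, hf, hfx⟩ := exists_func _ hxW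
    obtain ⟨x0, hx0, hfx0⟩ : ∃ x0 ∈ Q, f x0 ≠ f u := by
      by_contra! hall
      exact hfx (vs_le_ker hall hxQ)
    obtain ⟨y, hy, hsub, hfy⟩ := exists_edge hP hQ f hu huQ hx0 hfx0
    have hyS := right_mem_segment ℝ u y
    have huS := left_mem_segment ℝ u y
    have hconv : ∀ x ∈ segment ℝ u y, ∃ r : ℝ, 0 ≤ r ∧ ℓ x = ℓ u + r * (ℓ y - ℓ u) := by
      intro x hx
      rw [segment_eq_image'] at hx
      obtain ⟨r, hr, rfl⟩ := hx
      exact ⟨r, hr.1, by simp⟩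
    rcases lt_or_gt_of_ne (hℓ u y hy) with h | h
    · have hm : MinAt ℓ (segment ℝ u y) u := by
        refine ⟨huS, fun x hx => ?_⟩
        obtain ⟨r, hr, he⟩ := hconv x hx
        nlinarith
      have hs := sub_Fpos hP (hirr u hu).2 hy.2 hm
      exact hfy (const_of_ker (le_sup_right.trans hf) ⟨hs hyS, hsub hyS⟩ ⟨hs huS, hsub huS⟩)
    · have hm : MaxAt ℓ (segment ℝ u y) u := by
        refine ⟨huS, fun x hx => ?_⟩
        obtain ⟨r, hr, he⟩ := hconv x hx
        nlinarith
      have hs := sub_Fneg hP (hirr u hu).1 hy.2 hm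
      exact hfy (const_of_ker (le_sup_left.trans hf) (hs hyS) (hs huS))
  exact (Submodule.finrank_mono hle).trans (Submodule.finrank_add_le_finrank_add_finrank _ _)

theorem dim_formula (hP : IsPolytope P) (hℓ : NonconstOnEdges P ℓ)
    (hirr : ∀ v, IsVertex P v → IsFace P (Fneg P ℓ v) ∧ IsFace P (Fpos P ℓ v))
    (hstrat : StratNeg P ℓ) {u w : V} (hu : IsVertex P u) (hw : IsVertex P w)
    (how : ORel P ℓ u w) :
    dimS (Fneg P ℓ u) + dimS (Fpos P ℓ u ∩ Fneg P ℓ w) = dimS (Fneg P ℓ w) := by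
  obtain ⟨G, hG, hmin, hmax⟩ := how
  have h1 := sub_Fneg hP (hirr w hw).1 hG hmax
  have h2 := sub_Fpos hP (hirr u hu).2 hG hmin
  apply le_antisymm
  · exact upper_bound hP hℓ hirr hstrat hu _ _ w rfl
      ⟨⟨u, h2 hmin.1, h1 hmin.1⟩, (hirr u hu).2.2.inter (hirr w hw).1.2⟩ hw
      ⟨⟨h2 hmin.1, h1 hmin.1⟩, fun x hx => (minAt_Fpos hu).2 x hx.1⟩
      ⟨⟨h2 hmax.1, h1 hmax.1⟩, fun x hx => (maxAt_Fneg hw).2 x hx.2⟩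
  · exact lower_bound hP hℓ hirr hu (hirr w hw).1 (h1 hmin.1)

end main

/-- Under the Stratification Assumption (irreducibility plus `O⁻`
a stratification), if `O(u,w)` holds then
`dim F⁻(u) + dim (F⁺(u) ∩ F⁻(w)) + dim F⁺(w) = dim P`. -/
theorem stmt18 (P : Set V) (hP : IsPolytope P) (ℓ : V →L[ℝ] ℝ)
    (hℓ : NonconstOnEdges P ℓ)
    (hirr : ∀ v, IsVertex P v → IsFace P (Fneg P ℓ v) ∧ IsFace P (Fpos P ℓ v))
    (hstrat : StratNeg P ℓ)
    (u w : V) (hu : IsVertex P u) (hw : IsVertex P w) (how : ORel P ℓ u w) :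
    dimS (Fneg P ℓ u) + dimS (Fpos P ℓ u ∩ Fneg P ℓ w) + dimS (Fpos P ℓ w)
      = dimS P := by
  have h1 := dim_formula hP hℓ hirr hstrat hu hw how
  have hwF := (hirr w hw).2
  obtain ⟨v, hv, hmax⟩ := exists_max_vertex hP hwF ℓ
  have h2 := upper_bound hP hℓ hirr hstrat hw _ _ v rfl hwF hv (minAt_Fpos hw) hmax
  have hfin := poly_fin hP
  have h3 : dimS (Fneg P ℓ v) ≤ dimS P :=
    Submodule.finrank_mono (vectorSpan_mono ℝ (hirr v hv).1.2.subset)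
  have h4 := lower_bound hP hℓ hirr hw (face_refl hP) (hw.2.subset rfl)
  rw [inter_eq_left.2 hwF.2.subset] at h4
  omega
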